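/- (Skein exact triangle lemma) Suppose (C_i, d_i) for i ∈ Z is a family of cochain complexes (d_i ∘ d_i = 0) with chain maps f_i : C_i → C_{i+1} (so f_i d_i = d_{i+1} f_i), maps g_i : C_i → C_{i+2} satisfying f_{i+1}∘f_i + d_{i+2}∘g_i + g_i∘d_i = 0, and suppose the maps g_{i+1}∘f_i + f_{i+2}∘g_i : C_i → C_{i+3} induce isomorphisms on homology. Then the induced sequence on homology ... → H(C_i) → H(C_{i+1}) → H(C_{i+2}) → ... is exact at every term. -/

import Mathlib

/-- The homology of a module `M` over a commutative ring `R` equipped with a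
square-zero endomorphism `d`: `H(M, d) = ker d / im d` (the image is pulled
back inside the kernel). -/
def ChainHomology {R M : Type*} [CommRing R] [AddCommGroup M] [Module R M]
    (d : M →ₗ[R] M) : Type _ :=
  LinearMap.ker d ⧸ (LinearMap.range d).comap (LinearMap.ker d).subtype

noncomputable instance {R M : Type*} [CommRing R] [AddCommGroup M] [Module R M]
    (d : M →ₗ[R] M) : AddCommGroup (ChainHomology d) :=
  inferInstanceAs (AddCommGroup
    (LinearMap.ker d ⧸ (LinearMap.range d).comap (LinearMap.ker d).subtype))

noncomputable instance {R M : Type*} [CommRing R] [AddCommGroup M] [Module R M]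
    (d : M →ₗ[R] M) : Module R (ChainHomology d) :=
  inferInstanceAs (Module R
    (LinearMap.ker d ⧸ (LinearMap.range d).comap (LinearMap.ker d).subtype))

/-- The map induced on homology by a chain map `φ : (M, d) → (N, e)`. -/
noncomputable def inducedOnHomology {R M N : Type*} [CommRing R]
    [AddCommGroup M] [Module R M] [AddCommGroup N] [Module R N]
    (d : M →ₗ[R] M) (e : N →ₗ[R] N)
    (φ : M →ₗ[R] N) (hφ : φ ∘ₗ d = e ∘ₗ φ) :
    ChainHomology d →ₗ[R] ChainHomology e :=
  Submodule.liftQ _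
    ((Submodule.mkQ _).comp (φ.restrict (p := LinearMap.ker d) (q := LinearMap.ker e)
      (fun x hx => by
        have h := LinearMap.congr_fun hφ x
        simp only [LinearMap.mem_ker] at hx ⊢
        simpa [LinearMap.comp_apply, hx] using h.symm)))
    (fun x hx => by
      rw [Submodule.mem_comap, LinearMap.mem_range] at hx
      rcases hx with ⟨y, hy⟩
      have h := LinearMap.congr_fun hφ y
      simp only [LinearMap.comp_apply] at h
      refine (Submodule.Quotient.mk_eq_zero _).mpr ?_
      refine Submodule.mem_comap.mpr ?_
      exact ⟨φ y, by simp [LinearMap.restrict_apply, ← h, hy]⟩)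

theorem induced_surj_elt {R M N : Type*} [CommRing R]
    [AddCommGroup M] [Module R M] [AddCommGroup N] [Module R N]
    (d : M →ₗ[R] M) (e : N →ₗ[R] N) (φ : M →ₗ[R] N) (hφ : φ ∘ₗ d = e ∘ₗ φ)
    (h : Function.Surjective (inducedOnHomology d e φ hφ)) (y : N) (hy : e y = 0) :
    ∃ x t, d x = 0 ∧ φ x = y + e t := by
  obtain ⟨q, hq⟩ := h (Submodule.Quotient.mk ⟨y, hy⟩)
  obtain ⟨⟨x, hx⟩, rfl⟩ := Submodule.Quotient.mk_surjective _ q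
  have h2 := (Submodule.Quotient.eq _).1 hq
  obtain ⟨t, ht⟩ := h2
  refine ⟨x, t, hx, ?_⟩
  have ht2 : e t = φ x - y := ht
  rw [ht2]; abel

theorem induced_inj_elt {R M N : Type*} [CommRing R]
    [AddCommGroup M] [Module R M] [AddCommGroup N] [Module R N]
    (d : M →ₗ[R] M) (e : N →ₗ[R] N) (φ : M →ₗ[R] N) (hφ : φ ∘ₗ d = e ∘ₗ φ)
    (h : Function.Injective (inducedOnHomology d e φ hφ)) (x : M) (hx : d x = 0)
    (t : N) (ht : φ x = e t) : ∃ s, d s = x := by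
  have h1 : inducedOnHomology d e φ hφ (Submodule.Quotient.mk ⟨x, hx⟩) = 0 :=
    (Submodule.Quotient.mk_eq_zero _).2 ⟨t, ht.symm⟩
  have h2 := h (h1.trans (map_zero _).symm)
  obtain ⟨s, hs⟩ := (Submodule.Quotient.mk_eq_zero _).1 h2
  exact ⟨s, hs⟩

theorem induced_exact_of_elt {R M N K : Type*} [CommRing R]
    [AddCommGroup M] [Module R M] [AddCommGroup N] [Module R N] [AddCommGroup K] [Module R K]
    (d : M →ₗ[R] M) (e : N →ₗ[R] N) (c : K →ₗ[R] K)
    (φ : M →ₗ[R] N) (hφ : φ ∘ₗ d = e ∘ₗ φ) (χ : N →ₗ[R] K) (hχ : χ ∘ₗ e = c ∘ₗ χ)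
    (h1 : ∀ x, d x = 0 → ∃ t, c t = χ (φ x))
    (h2 : ∀ y z, e y = 0 → χ y = c z → ∃ x t, d x = 0 ∧ φ x = y + e t) :
    LinearMap.range (inducedOnHomology d e φ hφ) = LinearMap.ker (inducedOnHomology e c χ hχ) := by
  apply le_antisymm
  · rintro _ ⟨q, rfl⟩
    obtain ⟨⟨x, hx⟩, rfl⟩ := Submodule.Quotient.mk_surjective _ q
    obtain ⟨t, ht⟩ := h1 x hx
    exact (Submodule.Quotient.mk_eq_zero _).2 ⟨t, ht⟩
  · intro q hq
    obtain ⟨⟨y, hy⟩, rfl⟩ := Submodule.Quotient.mk_surjective _ q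
    obtain ⟨z, hz⟩ := (Submodule.Quotient.mk_eq_zero _).1 hq
    obtain ⟨x, t, hx, hxt⟩ := h2 y z hy hz.symm
    refine ⟨Submodule.Quotient.mk ⟨x, hx⟩, (Submodule.Quotient.eq _).2 ⟨t, ?_⟩⟩
    change e t = φ x - y
    rw [hxt]; abel

/-- Element-level heart of the argument: a cycle `y` with `f y = d z` has `ψ ψ y`
homologous to `f x` for a cycle `x`. -/
theorem skein_key
    (R : Type*) [CommRing R]
    (C : ℤ → Type*) [∀ i, AddCommGroup (C i)] [∀ i, Module R (C i)]
    (d : ∀ i, C i →ₗ[R] C i)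
    (hd : ∀ i x, d i (d i x) = 0)
    (f : ∀ i, C i →ₗ[R] C (i + 1))
    (hf : ∀ i x, f i (d i x) = d (i + 1) (f i x))
    (g : ∀ i, C i →ₗ[R] C (i + 1 + 1))
    (hfg : ∀ i x, f (i + 1) (f i x) + d (i + 1 + 1) (g i x) + g i (d i x) = 0)
    (P : ∀ i, C i →ₗ[R] C (i + 1 + 1 + 1))
    (hP : ∀ i x, P i x = g (i + 1) (f i x) + f (i + 1 + 1) (g i x))
    (hPd : ∀ i x, P i (d i x) = d (i + 1 + 1 + 1) (P i x)) :
    (∀ i x, f _ (P i x) = P _ (f i x) + g _ (g _ (d _ x)) - d _ (g _ (g _ x))) ∧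
    ∀ i y z, d i y = 0 → f i y = d (i + 1) z →
      ∃ x t, d (i + 1 + 1 + 1 + 1 + 1) x = 0 ∧ f _ x = P _ (P _ y) + d _ t := by
  have hdg : ∀ i x, d (i + 1 + 1) (g i x) = - f (i + 1) (f i x) - g i (d i x) := by
    intro i x
    linear_combination (norm := module) hfg i x
  have A : ∀ i x, f _ (P i x) = P _ (f i x) + g _ (g _ (d _ x)) - d _ (g _ (g _ x)) := by
    intro i x
    simp only [hP, hdg, map_add, map_sub, map_neg]
    abel
  have B : ∀ i x, g _ (P i x) = P _ (g i x) + g _ (g _ (f _ x)) - f _ (g _ (g _ x)) := by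
    intro i x
    simp only [hP, map_add]
    abel
  have E : ∀ i x, (2 : ℤ) • f _ (f _ (f i x)) + (2 : ℤ) • P _ (d i x) = 0 := by
    intro i x
    have h := hPd i x
    rw [hP i x, map_add, hdg, ← hf, ← hf _ (g i x), hdg, hP] at h
    simp only [map_sub, map_neg, ← hf] at h
    rw [hP]
    linear_combination (norm := module) h
  have F : ∀ i x, (2 : ℤ) • d _ (g _ (g _ (d i x))) = 0 := by
    intro i x
    have h1 := congrArg (f _) (E i x)
    have h2 := E _ (f i x)
    have h3 := A i (d i x)
    rw [hd, map_zero, map_zero, ] at h3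
    rw [← hf] at h2
    simp only [map_add, map_zsmul, map_zero] at h1
    linear_combination (norm := module) h2 - h1 + (2 : ℤ) • h3
  refine ⟨A, ?_⟩
  intro i y z hy hz
  have hw : d _ (g i y + f _ z) = 0 := by
    rw [map_add, hdg, hy, ← hf, ← hz, map_zero]; abel
  have hfw : f _ (g i y + f _ z) = P _ y - (2 : ℤ) • g _ (f _ y) - d _ (g _ z) := by
    rw [map_add, hdg, hP, ← hz]
    module
  have E0 := E i y
  rw [hy, map_zero, smul_zero, add_zero] at E0
  have F0 := F _ z
  rw [← hz] at F0
  have h3 : (2 : ℤ) • d _ (f _ (g _ (f _ z))) = (0 : C (i + 1 + 1 + 1 + 1 + 1)) := by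
    have e1 := F0
    rw [hdg, hdg, ← hf, hy, map_zero, map_zero] at e1
    have e2 := congrArg (g _) E0
    simp only [map_sub, map_neg, map_zero, map_zsmul, smul_sub, smul_neg] at e1 e2
    have e3 := congrArg (f _) (E _ z)
    rw [← hf, hdg, ← hf, ← hz]
    rw [← hz, hP] at e3
    simp only [map_sub, map_neg, map_zero, map_zsmul, map_add, smul_sub, smul_neg, smul_add] at e3 ⊢
    linear_combination (norm := module) e2 - e1 - e3
  refine ⟨P _ (g i y + f _ z) - (2 : ℤ) • f _ (g _ (f _ z)) + (2 : ℤ) • g _ (g _ (f _ y)),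
    - P _ (g _ z) - g _ (g _ (g i y + f _ z)) + (2 : ℤ) • g _ (g _ (f _ z)), ?_, ?_⟩
  · rw [map_add, map_sub, map_zsmul, map_zsmul, h3, F0, ← hPd, hw, map_zero]; abel
  · have a1 := A _ (g i y + f _ z)
    rw [hw, map_zero, map_zero, hfw] at a1
    have a2 := hdg _ (g _ (f _ z))
    have a3 := hdg _ (f _ z)
    rw [← hf, ← hz] at a3
    have a4 := congrArg (g _) (E _ z)
    rw [← hz] at a4
    have a5 := B _ (f _ y)
    rw [a3] at a2
    have a6 := hPd _ (g _ z)
    simp only [map_sub, map_neg, map_zero, map_zsmul, map_add, smul_sub, smul_neg, smul_add] at a1 a2 a4 a5 a6 ⊢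
    linear_combination (norm := module) a1 - (2 : ℤ) • a2 - a4 + (2 : ℤ) • a5 - a6

theorem skein_final
    (R : Type*) [CommRing R]
    (C : ℤ → Type*) [∀ i, AddCommGroup (C i)] [∀ i, Module R (C i)]
    (d : ∀ i, C i →ₗ[R] C i)
    (f : ∀ i, C i →ₗ[R] C (i + 1))
    (hf : ∀ i x, f i (d i x) = d (i + 1) (f i x))
    (g : ∀ i, C i →ₗ[R] C (i + 1 + 1))
    (P : ∀ i, C i →ₗ[R] C (i + 1 + 1 + 1))
    (hPd : ∀ i x, P i (d i x) = d (i + 1 + 1 + 1) (P i x))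
    (A : ∀ i x, f _ (P i x) = P _ (f i x) + g _ (g _ (d _ x)) - d _ (g _ (g _ x)))
    (K : ∀ i y z, d i y = 0 → f i y = d (i + 1) z →
      ∃ x t, d (i + 1 + 1 + 1 + 1 + 1) x = 0 ∧ f _ x = P _ (P _ y) + d _ t)
    (S : ∀ i y, d (i + 1 + 1 + 1) y = 0 → ∃ x t, d i x = 0 ∧ P i x = y + d _ t)
    (I : ∀ i x, d i x = 0 → ∀ t, P i x = d _ t → ∃ s, d i s = x)
    (i : ℤ) (y : C (i + 1)) (z : C (i + 1 + 1)) (hy : d _ y = 0) (hz : f _ y = d _ z) :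
    ∃ x t, d i x = 0 ∧ f i x = y + d _ t := by
  obtain ⟨x, t, hx, hxt⟩ := K _ y z hy hz
  obtain ⟨x1, t1, hx1, hxt1⟩ := S _ x hx
  obtain ⟨x0, t0, hx0, hxt0⟩ := S _ x1 hx1
  have hv : d _ (f i x0 - y) = 0 := by
    rw [map_sub, ← hf, hx0, hy, map_zero, sub_zero]
  have a0 := A i x0
  have a1 := A _ x1
  rw [hx0, map_zero, map_zero, hxt0, map_add, hf] at a0
  rw [hx1, map_zero, map_zero, hxt1, map_add, hf, hxt] at a1
  have a2 := congrArg (P _) a0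
  simp only [map_add, map_sub, map_zero, hPd] at a2
  obtain ⟨s1, hs1⟩ := I _ (P _ (f i x0 - y)) (by rw [← hPd, hv, map_zero])
    (t + f _ t1 + g _ (g _ x1) + P _ (f _ t0) + P _ (g _ (g _ x0))) (by
      simp only [map_add, map_sub]
      linear_combination (norm := module) -a1 - a2)
  obtain ⟨s, hs⟩ := I _ _ hv s1 hs1.symm
  exact ⟨x0, s, hx0, by rw [hs]; abel⟩

/-- The skein exact triangle lemma: given cochain complexes `(Cᵢ, dᵢ)` of modules
over a commutative ring `R`, chain maps `fᵢ : Cᵢ → Cᵢ₊₁`, homotopies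
`gᵢ : Cᵢ → Cᵢ₊₂` with `fᵢ₊₁∘fᵢ + dᵢ₊₂∘gᵢ + gᵢ∘dᵢ = 0`, such that the chain maps
`gᵢ₊₁∘fᵢ + fᵢ₊₂∘gᵢ : Cᵢ → Cᵢ₊₃` induce isomorphisms on homology,
the induced sequence `… → H(Cᵢ) → H(Cᵢ₊₁) → H(Cᵢ₊₂) → …` is exact. -/
theorem skein_exact_triangle
    (R : Type*) [CommRing R]
    (C : ℤ → Type*) [∀ i, AddCommGroup (C i)] [∀ i, Module R (C i)]
    (d : ∀ i, C i →ₗ[R] C i)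
    (hd : ∀ i, d i ∘ₗ d i = 0)
    (f : ∀ i, C i →ₗ[R] C (i + 1))
    (hf : ∀ i, f i ∘ₗ d i = d (i + 1) ∘ₗ f i)
    (g : ∀ i, C i →ₗ[R] C (i + 1 + 1))
    (hfg : ∀ i, f (i + 1) ∘ₗ f i + d (i + 1 + 1) ∘ₗ g i + g i ∘ₗ d i = 0)
    (hchain : ∀ i, (g (i + 1) ∘ₗ f i + f (i + 1 + 1) ∘ₗ g i) ∘ₗ d i
        = d (i + 1 + 1 + 1) ∘ₗ (g (i + 1) ∘ₗ f i + f (i + 1 + 1) ∘ₗ g i))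
    (hiso : ∀ i, Function.Bijective
        (inducedOnHomology (d i) (d (i + 1 + 1 + 1))
          (g (i + 1) ∘ₗ f i + f (i + 1 + 1) ∘ₗ g i) (hchain i))) :
    ∀ i, LinearMap.range (inducedOnHomology (d i) (d (i + 1)) (f i) (hf i))
        = LinearMap.ker (inducedOnHomology (d (i + 1)) (d (i + 1 + 1)) (f (i + 1)) (hf (i + 1))) := by
  intro i
  obtain ⟨A, K⟩ := skein_key R C d (fun i x => LinearMap.congr_fun (hd i) x) f
    (fun i x => LinearMap.congr_fun (hf i) x) g (fun i x => LinearMap.congr_fun (hfg i) x)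
    (fun i => g (i + 1) ∘ₗ f i + f (i + 1 + 1) ∘ₗ g i) (fun i x => rfl)
    (fun i x => LinearMap.congr_fun (hchain i) x)
  apply induced_exact_of_elt
  · intro x hx
    refine ⟨- g i x, ?_⟩
    have h := LinearMap.congr_fun (hfg i) x
    simp only [LinearMap.add_apply, LinearMap.comp_apply, hx, map_zero, LinearMap.zero_apply] at h
    rw [map_neg]
    linear_combination (norm := module) -h
  · exact skein_final R C d f (fun i x => LinearMap.congr_fun (hf i) x) g
      (fun i => g (i + 1) ∘ₗ f i + f (i + 1 + 1) ∘ₗ g i)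
      (fun i x => LinearMap.congr_fun (hchain i) x) A K
      (fun i => induced_surj_elt _ _ _ _ (hiso i).2)
      (fun i => induced_inj_elt _ _ _ _ (hiso i).1) i
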